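/- Let d ≥ 1, R > 0, δ > 0, let μ be a probability measure on ℝ^d supported in the closed Euclidean ball B(0,R), and let S be a random variable with law μ⋆γ_δ. Set C = δ² + 4R². Then for every convex (measurable) function g : ℝ^d → ℝ bounded below, E[exp(Q_C g(S))] · E[exp(−g(S))] ≤ 1, where Q_s g(x) = inf_{y ∈ ℝ^d} { g(y) + |x − y|²/(4s) } is the infimum-convolution operator. -/

import Mathlib

open MeasureTheory Metric Real

/-- The Gaussian measure `N(0, δ² I_d)` on `ℝ^d`. -/
noncomputable def gaussδ (d : ℕ) (δ : ℝ) : Measure (EuclideanSpace ℝ (Fin d)) :=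
  volume.withDensity fun z =>
    ENNReal.ofReal ((2 * π * δ ^ 2) ^ (-(d : ℝ) / 2) * Real.exp (-‖z‖ ^ 2 / (2 * δ ^ 2)))

/-- Convolution of two measures on `ℝ^d`. -/
noncomputable def mconv {d : ℕ} (μ ν : Measure (EuclideanSpace ℝ (Fin d))) :
    Measure (EuclideanSpace ℝ (Fin d)) :=
  (μ.prod ν).map fun p => p.1 + p.2

/-- The infimum-convolution operator
`Q_s g(x) = inf_y { g(y) + |x - y|²/(4s) }`. -/
noncomputable def infConv {d : ℕ} (s : ℝ) (g : EuclideanSpace ℝ (Fin d) → ℝ)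
    (x : EuclideanSpace ℝ (Fin d)) : ℝ :=
  ⨅ y : EuclideanSpace ℝ (Fin d), (g y + ‖x - y‖ ^ 2 / (4 * s))


open scoped ENNReal

theorem bm_compact (K L C : Set ℝ) (hK : IsCompact K) (hL : IsCompact L)
    (hKn : K.Nonempty) (hLn : L.Nonempty)
    (h : ∀ a ∈ K, ∀ b ∈ L, (a + b) / 2 ∈ C) :
    volume K + volume L ≤ 2 * volume C := by
  obtain ⟨k, hkK, hk⟩ := hK.exists_isGreatest hKn
  obtain ⟨l, hlL, hl⟩ := hL.exists_isLeast hLn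
  have hC : volume ((fun x : ℝ => (2⁻¹ : ℝ) • x) ⁻¹' C) = 2 * volume C := by
    rw [Measure.addHaar_preimage_smul volume (by norm_num)]
    simp
  rw [← hC]
  have h1 : volume ((fun x => x + (-l)) ⁻¹' K) = volume K := measure_preimage_add_right _ _ _
  have h2 : volume ((fun x => x + (-k)) ⁻¹' L) = volume L := measure_preimage_add_right _ _ _
  rw [← h1, ← h2]
  have hd : AEDisjoint volume ((fun x => x + (-l)) ⁻¹' K) ((fun x => x + (-k)) ⁻¹' L) := by
    refine measure_mono_null (t := {k + l}) ?_ (by simp)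
    rintro x ⟨hx1, hx2⟩
    have := hk hx1
    have := hl hx2
    simp only [Set.mem_singleton_iff] at *
    linarith
  have hm : MeasurableSet ((fun x => x + (-k)) ⁻¹' L) :=
    (measurable_id.add_const _) hL.measurableSet
  rw [← measure_union₀ hm.nullMeasurableSet hd]
  apply measure_mono
  rintro x (hx | hx)
  · have := h _ hx l hlL
    simpa [div_eq_inv_mul] using this
  · have := h k hkK _ hx
    simpa [div_eq_inv_mul] using this

theorem bm_meas (A B C : Set ℝ) (hA : MeasurableSet A) (hB : MeasurableSet B)
    (hAn : A.Nonempty) (hBn : B.Nonempty)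
    (h : ∀ a ∈ A, ∀ b ∈ B, (a + b) / 2 ∈ C) :
    volume A + volume B ≤ 2 * volume C := by
  obtain ⟨a0, ha0⟩ := hAn
  obtain ⟨b0, hb0⟩ := hBn
  have hform : ∀ S : Set ℝ, MeasurableSet S →
      volume S = ⨆ (K : Set ℝ) (_ : K ⊆ S ∧ IsCompact K), volume K := by
    intro S hS
    rw [hS.measure_eq_iSup_isCompact]
    refine iSup_congr fun K => ?_
    rw [iSup_and]
  rw [hform A hA, hform B hB]
  refine ENNReal.biSup_add_biSup_le' ⟨∅, by simp⟩ ⟨∅, by simp⟩ ?_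
  rintro K ⟨hK1, hK2⟩ L ⟨hL1, hL2⟩
  calc volume K + volume L ≤ volume (insert a0 K) + volume (insert b0 L) := by
        gcongr <;> exact Set.subset_insert _ _
    _ ≤ _ := by
        apply bm_compact _ _ _ (hK2.insert _) (hL2.insert _) ⟨a0, by simp⟩ ⟨b0, by simp⟩
        intro a ha b hb
        exact h a (Set.insert_subset ha0 hK1 ha) b (Set.insert_subset hb0 hL1 hb)

theorem pl_norm (u v w : ℝ → ℝ) (hu : Measurable u) (hv : Measurable v) (hw : Measurable w)
    (hu0 : ∀ x, 0 ≤ u x) (hv0 : ∀ x, 0 ≤ v x) (hw0 : ∀ x, 0 ≤ w x)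
    (hu1 : ∀ x, u x ≤ 1) (hv1 : ∀ x, v x ≤ 1)
    (hus : ∀ t < 1, ∃ x, t < u x) (hvs : ∀ t < 1, ∃ x, t < v x)
    (h : ∀ x y, u x * v y ≤ w ((x + y) / 2) ^ 2) :
    (∫⁻ x, ENNReal.ofReal (u x)) + (∫⁻ x, ENNReal.ofReal (v x))
      ≤ 2 * ∫⁻ x, ENNReal.ofReal (w x) := by
  rw [lintegral_eq_lintegral_meas_lt volume (.of_forall hu0) hu.aemeasurable,
    lintegral_eq_lintegral_meas_lt volume (.of_forall hv0) hv.aemeasurable,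
    lintegral_eq_lintegral_meas_lt volume (.of_forall hw0) hw.aemeasurable]
  have hmeas : Measurable fun t : ℝ => volume {a | t < u a} :=
    Antitone.measurable (fun s t hst => measure_mono fun x hx => lt_of_le_of_lt hst hx)
  have hmeasw : Measurable fun t : ℝ => volume {a | t < w a} :=
    Antitone.measurable (fun s t hst => measure_mono fun x hx => lt_of_le_of_lt hst hx)
  rw [← lintegral_add_left hmeas, ← lintegral_const_mul _ hmeasw]
  refine setLIntegral_mono' measurableSet_Ioi fun t (ht : 0 < t) => ?_
  rcases lt_or_ge t 1 with h1 | h1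
  · apply bm_meas _ _ _ (measurableSet_lt measurable_const hu) (measurableSet_lt measurable_const hv)
      (hus t h1) (hvs t h1)
    intro a (ha : t < u a) b (hb : t < v b)
    have := h a b
    show t < w _
    refine lt_of_pow_lt_pow_left₀ 2 (hw0 _) ?_
    nlinarith
  · have e1 : {a | t < u a} = ∅ := by
      ext x; simp; linarith [hu1 x]
    have e2 : {a | t < v a} = ∅ := by
      ext x; simp; linarith [hv1 x]
    simp [e1, e2]

theorem pl_real (N : ℝ) (u v w : ℝ → ℝ) (hu : Measurable u) (hv : Measurable v) (hw : Measurable w)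
    (hu0 : ∀ x, 0 ≤ u x) (hv0 : ∀ x, 0 ≤ v x) (hw0 : ∀ x, 0 ≤ w x)
    (hu1 : ∀ x, u x ≤ N) (hv1 : ∀ x, v x ≤ N)
    (h : ∀ x y, u x * v y ≤ w ((x + y) / 2) ^ 2) :
    (∫⁻ x, ENNReal.ofReal (u x)) * (∫⁻ x, ENNReal.ofReal (v x))
      ≤ (∫⁻ x, ENNReal.ofReal (w x)) ^ 2 := by
  have bu : BddAbove (Set.range u) := ⟨N, by rintro _ ⟨x, rfl⟩; exact hu1 x⟩
  have bv : BddAbove (Set.range v) := ⟨N, by rintro _ ⟨x, rfl⟩; exact hv1 x⟩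
  set a := ⨆ x, u x with ha
  set b := ⨆ x, v x with hb
  have hua : ∀ x, u x ≤ a := fun x => le_ciSup bu x
  have hvb : ∀ x, v x ≤ b := fun x => le_ciSup bv x
  rcases (le_trans (hu0 0) (hua 0)).eq_or_lt with h0 | ha0
  · have : ∀ x, u x = 0 := fun x => le_antisymm (h0 ▸ hua x) (hu0 x)
    simp [this]
  rcases (le_trans (hv0 0) (hvb 0)).eq_or_lt with h0 | hb0
  · have : ∀ x, v x = 0 := fun x => le_antisymm (h0 ▸ hvb x) (hv0 x)
    simp [this]
  set c := √(a * b) with hc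
  have hc0 : 0 < c := by positivity
  have hc2 : c ^ 2 = a * b := Real.sq_sqrt (by positivity)
  have key := pl_norm (fun x => a⁻¹ * u x) (fun x => b⁻¹ * v x) (fun x => c⁻¹ * w x)
    (hu.const_mul _) (hv.const_mul _) (hw.const_mul _)
    (fun x => by have := hu0 x; positivity) (fun x => by have := hv0 x; positivity)
    (fun x => by have := hw0 x; positivity)
    (fun x => by rw [inv_mul_le_iff₀ ha0]; linarith [hua x])
    (fun x => by rw [inv_mul_le_iff₀ hb0]; linarith [hvb x])
    (fun t ht => by
      obtain ⟨x, hx⟩ := exists_lt_of_lt_ciSup (show a * t < ⨆ x, u x by rw [← ha]; nlinarith)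
      exact ⟨x, by rw [lt_inv_mul_iff₀ ha0]; exact hx⟩)
    (fun t ht => by
      obtain ⟨x, hx⟩ := exists_lt_of_lt_ciSup (show b * t < ⨆ x, v x by rw [← hb]; nlinarith)
      exact ⟨x, by rw [lt_inv_mul_iff₀ hb0]; exact hx⟩)
    (fun x y => by
      rw [mul_pow, inv_pow, hc2, mul_inv]
      have := mul_le_mul_of_nonneg_left (h x y) (show 0 ≤ a⁻¹ * b⁻¹ by positivity)
      linarith)
  have ea : ∀ (r : ℝ) (f : ℝ → ℝ), 0 < r → Measurable f →
      ∫⁻ x, ENNReal.ofReal (r⁻¹ * f x) = ENNReal.ofReal r⁻¹ * ∫⁻ x, ENNReal.ofReal (f x) := by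
    intro r f hr hf
    rw [← lintegral_const_mul _ hf.ennreal_ofReal]
    congr with x
    rw [ENNReal.ofReal_mul (by positivity)]
  rw [ea a u ha0 hu, ea b v hb0 hv, ea c w hc0 hw] at key
  generalize (∫⁻ x, ENNReal.ofReal (u x)) = U at *
  generalize (∫⁻ x, ENNReal.ofReal (v x)) = V at *
  generalize (∫⁻ x, ENNReal.ofReal (w x)) = W at *
  rcases eq_or_ne W ∞ with rfl | hW
  · simp
  have hR : 2 * (ENNReal.ofReal c⁻¹ * W) ≠ ∞ :=
    ENNReal.mul_ne_top (by simp) (ENNReal.mul_ne_top (by simp) hW)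
  have hL := ne_top_of_le_ne_top hR key
  rw [ENNReal.add_ne_top] at hL
  have hU : U ≠ ∞ := by
    rintro rfl
    apply hL.1
    rw [ENNReal.mul_top]; simpa using ha0
  have hV : V ≠ ∞ := by
    rintro rfl
    apply hL.2
    rw [ENNReal.mul_top]; simpa using hb0
  lift U to NNReal using hU
  lift V to NNReal using hV
  lift W to NNReal using hW
  have key' := ENNReal.toReal_mono hR key
  rw [ENNReal.toReal_add hL.1 hL.2] at key'
  simp only [ENNReal.toReal_mul, ENNReal.toReal_ofReal (inv_nonneg.2 ha0.le),
    ENNReal.toReal_ofReal (inv_nonneg.2 hb0.le), ENNReal.toReal_ofReal (inv_nonneg.2 hc0.le),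
    ENNReal.coe_toReal, ENNReal.toReal_ofNat] at key'
  have : (U * V : ℝ) ≤ W ^ 2 := by
    have p0 : 0 ≤ a⁻¹ * (U : ℝ) := by positivity
    have q0 : 0 ≤ b⁻¹ * (V : ℝ) := by positivity
    have h4 : (a⁻¹ * (U : ℝ)) * (b⁻¹ * V) ≤ (c⁻¹ * W) ^ 2 := by
      nlinarith [sq_nonneg (a⁻¹ * (U : ℝ) - b⁻¹ * V)]
    rw [mul_pow, inv_pow, hc2] at h4
    have h5 := mul_le_mul_of_nonneg_left h4 (show 0 ≤ a * b by positivity)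
    field_simp at h5
    linarith
  exact_mod_cast this

theorem pl_bdd (N : NNReal) (u v w : ℝ → ℝ≥0∞) (hu : Measurable u) (hv : Measurable v)
    (hw : Measurable w) (hu1 : ∀ x, u x ≤ N) (hv1 : ∀ x, v x ≤ N)
    (h : ∀ x y, u x * v y ≤ w ((x + y) / 2) ^ 2) :
    (∫⁻ x, u x) * (∫⁻ x, v x) ≤ (∫⁻ x, w x) ^ 2 := by
  have hut : ∀ x, u x ≠ ∞ := fun x => ne_top_of_le_ne_top ENNReal.coe_ne_top (hu1 x)
  have hvt : ∀ x, v x ≠ ∞ := fun x => ne_top_of_le_ne_top ENNReal.coe_ne_top (hv1 x)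
  have hwt : ∀ x, min (w x) N ≠ ∞ := fun x => 
    ne_top_of_le_ne_top ENNReal.coe_ne_top (min_le_right _ _)
  have key := pl_real N (fun x => (u x).toReal) (fun x => (v x).toReal)
    (fun x => (min (w x) N).toReal) hu.ennreal_toReal hv.ennreal_toReal
    (hw.min measurable_const).ennreal_toReal
    (fun _ => ENNReal.toReal_nonneg) (fun _ => ENNReal.toReal_nonneg)
    (fun _ => ENNReal.toReal_nonneg)
    (fun x => by simpa using ENNReal.toReal_mono ENNReal.coe_ne_top (hu1 x))
    (fun x => by simpa using ENNReal.toReal_mono ENNReal.coe_ne_top (hv1 x))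
    (fun x y => by
      rw [← ENNReal.toReal_mul, ← ENNReal.toReal_pow]
      apply ENNReal.toReal_mono (ENNReal.pow_ne_top (hwt _))
      rcases min_choice (w ((x + y) / 2)) (N : ℝ≥0∞) with e | e <;> rw [e]
      · exact h x y
      · rw [sq]; exact mul_le_mul' (hu1 x) (hv1 y))
  simp only [ENNReal.ofReal_toReal (hut _), ENNReal.ofReal_toReal (hvt _),
    ENNReal.ofReal_toReal (hwt _)] at key
  refine key.trans ?_
  gcongr
  exact min_le_left _ _

/-- Midpoint Prekopa-Leindler property of a measure. -/
def PLProp {E : Type*} [AddCommGroup E] [Module ℝ E] [MeasurableSpace E] (m : Measure E) : Prop :=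
  ∀ u v w : E → ℝ≥0∞, Measurable u → Measurable v → Measurable w →
    (∀ x y, u x * v y ≤ w ((2⁻¹ : ℝ) • (x + y)) ^ 2) →
    (∫⁻ x, u x ∂m) * (∫⁻ x, v x ∂m) ≤ (∫⁻ x, w x ∂m) ^ 2

theorem lint_trunc (u : ℝ → ℝ≥0∞) (hu : Measurable u) :
    ∫⁻ x, u x = ⨆ n : ℕ, ∫⁻ x, min (u x) n := by
  rw [← lintegral_iSup (fun n => hu.min measurable_const)]
  · congr with x
    have := inf_iSup_eq (u x) (fun n : ℕ => (n : ℝ≥0∞))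
    rw [ENNReal.iSup_natCast, inf_top_eq] at this
    exact this
  · intro m n hmn x
    exact min_le_min le_rfl (by exact_mod_cast hmn)

theorem pl_one : PLProp (volume : Measure ℝ) := by
  intro u v w hu hv hw h
  rw [lint_trunc u hu, lint_trunc v hv, ENNReal.iSup_mul]
  refine iSup_le fun n => ?_
  rw [ENNReal.mul_iSup]
  refine iSup_le fun m => ?_
  refine pl_bdd (n + m : ℕ) _ _ w (hu.min measurable_const) (hv.min measurable_const) hw
    (fun x => (min_le_right _ _).trans (by exact_mod_cast (by omega)))
    (fun x => (min_le_right _ _).trans (by exact_mod_cast (by omega))) ?_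
  intro x y
  refine (mul_le_mul' (min_le_left _ _) (min_le_left _ _)).trans ((h x y).trans ?_)
  rw [smul_eq_mul, div_eq_inv_mul]

theorem pl_prod {E F : Type*} [AddCommGroup E] [Module ℝ E] [MeasurableSpace E]
    [AddCommGroup F] [Module ℝ F] [MeasurableSpace F] (m : Measure E) (n : Measure F)
    [SFinite n] (hm : PLProp m) (hn : PLProp n) : PLProp (m.prod n) := by
  intro u v w hu hv hw h
  rw [lintegral_prod _ hu.aemeasurable, lintegral_prod _ hv.aemeasurable,
    lintegral_prod _ hw.aemeasurable]
  refine hm _ _ _ hu.lintegral_prod_right' hv.lintegral_prod_right' hw.lintegral_prod_right' ?_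
  intro x y
  refine hn _ _ _ (hu.comp measurable_prodMk_left) (hv.comp measurable_prodMk_left)
    (hw.comp measurable_prodMk_left) ?_
  intro x' y'
  exact h (x, x') (y, y')

theorem pl_map {E F : Type*} [AddCommGroup E] [Module ℝ E] [MeasurableSpace E]
    [AddCommGroup F] [Module ℝ F] [MeasurableSpace F] (m : Measure E) (n : Measure F)
    (f : E → F) (hf : MeasurePreserving f m n)
    (hlin : ∀ x y, f ((2⁻¹ : ℝ) • (x + y)) = (2⁻¹ : ℝ) • (f x + f y))
    (hm : PLProp m) : PLProp n := by
  intro u v w hu hv hw h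
  rw [← hf.lintegral_comp hu, ← hf.lintegral_comp hv, ← hf.lintegral_comp hw]
  refine hm _ _ _ (hu.comp hf.measurable) (hv.comp hf.measurable) (hw.comp hf.measurable) ?_
  intro x y
  have := h (f x) (f y)
  rw [← hlin] at this
  exact this

theorem pl_pi (d : ℕ) : PLProp (volume : Measure (Fin d → ℝ)) := by
  induction d with
  | zero =>
    intro u v w hu hv hw h
    rw [volume_pi, Measure.pi_of_empty _ (0 : Fin 0 → ℝ)]
    rw [lintegral_dirac, lintegral_dirac, lintegral_dirac]
    convert h 0 0
  | succ d ih =>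
    have hp := (volume_preserving_piFinSuccAbove (fun _ : Fin (d + 1) => ℝ) 0).symm
    refine pl_map _ _ _ hp ?_ (pl_prod _ _ pl_one ih)
    rintro ⟨x, x'⟩ ⟨y, y'⟩
    ext i
    refine Fin.cases ?_ (fun j => ?_) i <;> simp [MeasurableEquiv.piFinSuccAbove, mul_add]

theorem pl_euclid (d : ℕ) : PLProp (volume : Measure (EuclideanSpace ℝ (Fin d))) := 
  pl_map _ _ _ (PiLp.volume_preserving_toLp (Fin d)) (fun x y => by simp) (pl_pi d)


theorem exp_aux1 (a : ℝ) (h0 : 0 ≤ a) (h1 : a ≤ 1 / 2) : rexp (a - a ^ 2) + rexp (-a) ≤ 2 := by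
  have e1 := Real.exp_bound (x := -a) (by rw [abs_neg, abs_of_nonneg h0]; linarith)
    (n := 3) (by norm_num)
  have t0 : 0 ≤ a - a ^ 2 := by nlinarith
  have t1 : a - a ^ 2 ≤ 1 := by nlinarith
  have e2 := Real.exp_bound (x := a - a ^ 2) (by rw [abs_of_nonneg t0]; linarith)
    (n := 3) (by norm_num)
  rw [abs_neg, abs_of_nonneg h0] at e1
  rw [abs_of_nonneg t0] at e2
  have e1 := (abs_le.1 e1).2
  have e2 := (abs_le.1 e2).2
  norm_num [Finset.sum_range_succ, Nat.factorial] at e1 e2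
  have h3 : (a - a ^ 2) ^ 3 ≤ a ^ 3 := by
    gcongr; nlinarith [sq_nonneg a]
  have h4 : a ^ 4 ≤ a ^ 3 / 2 := by
    have : 0 ≤ a ^ 3 := by positivity
    nlinarith
  have : 0 ≤ a ^ 3 := by positivity
  nlinarith

/-- there is an interpolation parameter realizing the bound -/
theorem exp_aux (a : ℝ) (h0 : 0 ≤ a) : ∃ θ : ℝ, 0 ≤ θ ∧ θ ≤ 1 ∧
    rexp ((1 - θ) * a + θ ^ 2 / 4) + rexp (-a) ≤ 2 := by
  rcases le_total a (1 / 2) with h | h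
  · refine ⟨2 * a, by linarith, by linarith, ?_⟩
    convert exp_aux1 a h0 h using 3
    ring
  · refine ⟨1, by norm_num, le_rfl, ?_⟩
    have := exp_aux1 (1 / 2) (by norm_num) le_rfl
    have h2 : rexp (-a) ≤ rexp (-(1 / 2)) := Real.exp_le_exp.2 (by linarith)
    have h3 : rexp ((1 - 1) * a + 1 ^ 2 / 4) = rexp (1 / 2 - (1 / 2) ^ 2) := by norm_num
    linarith

theorem infConv_bdd {d : ℕ} {s : ℝ} (hs : 0 < s) (g : EuclideanSpace ℝ (Fin d) → ℝ)
    (hbdd : ∃ b : ℝ, ∀ y, b ≤ g y) (x : EuclideanSpace ℝ (Fin d)) :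
    BddBelow (Set.range fun y => g y + ‖x - y‖ ^ 2 / (4 * s)) := by
  obtain ⟨b, hb⟩ := hbdd
  refine ⟨b, ?_⟩
  rintro _ ⟨y, rfl⟩
  have := hb y
  have : 0 ≤ ‖x - y‖ ^ 2 / (4 * s) := by positivity
  simp only
  linarith

theorem infConv_meas {d : ℕ} {s : ℝ} (hs : 0 < s) (g : EuclideanSpace ℝ (Fin d) → ℝ)
    (hbdd : ∃ b : ℝ, ∀ y, b ≤ g y) : Measurable (infConv s g) := by
  refine UpperSemicontinuous.measurable ?_
  unfold infConv
  refine upperSemicontinuous_ciInf (infConv_bdd hs g hbdd) fun y => ?_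
  exact Continuous.upperSemicontinuous (by fun_prop)

theorem cost_split {E : Type*} [NormedAddCommGroup E] (p q : E) (s t : ℝ) (hs : 0 < s)
    (ht : 0 < t) : ‖p + q‖ ^ 2 / (4 * (t + s)) ≤ ‖p‖ ^ 2 / (4 * s) + ‖q‖ ^ 2 / (4 * t) := by
  have h := norm_add_le p q
  have h2 : ‖p + q‖ ^ 2 ≤ (‖p‖ + ‖q‖) ^ 2 := by gcongr
  rw [div_add_div _ _ (by positivity) (by positivity), div_le_div_iff₀ (by positivity) (by positivity)]
  have h3 : (‖p‖ + ‖q‖) ^ 2 * (s * t) ≤ (‖p‖ ^ 2 * t + ‖q‖ ^ 2 * s) * (t + s) := by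
    nlinarith [sq_nonneg (‖p‖ * t - ‖q‖ * s)]
  have h4 : ‖p + q‖ ^ 2 * (s * t) ≤ (‖p‖ + ‖q‖) ^ 2 * (s * t) := by gcongr
  nlinarith

theorem mu_step (d : ℕ) (R δ : ℝ) (hR : 0 < R) (hδ : 0 < δ)
    (μ : Measure (EuclideanSpace ℝ (Fin d))) [IsProbabilityMeasure μ]
    (hsupp : μ (closedBall (0 : EuclideanSpace ℝ (Fin d)) R)ᶜ = 0)
    (g : EuclideanSpace ℝ (Fin d) → ℝ) (hg : Measurable g)
    (hconv : ConvexOn ℝ Set.univ g) (hbdd : ∃ b : ℝ, ∀ y, b ≤ g y)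
    (z z' : EuclideanSpace ℝ (Fin d)) :
    (∫⁻ x, ENNReal.ofReal (rexp (infConv (δ ^ 2 + 4 * R ^ 2) g (x + z))) ∂μ) *
      (∫⁻ x, ENNReal.ofReal (rexp (-g (x + z'))) ∂μ) ≤
      ENNReal.ofReal (rexp (‖z - z'‖ ^ 2 / (4 * δ ^ 2))) := by
  have hcont : Continuous g := by
    rw [← continuousOn_univ]; exact hconv.continuousOn isOpen_univ
  obtain ⟨y0, hy0, hmin⟩ := (isCompact_closedBall (0 : EuclideanSpace ℝ (Fin d)) R).exists_isMinOn
    ⟨0, by simp [hR.le]⟩ (f := fun x => g (x + z')) (by fun_prop)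
  set m := g (y0 + z') with hm
  set k := ‖z - z'‖ ^ 2 / (4 * δ ^ 2) with hk
  have hae : ∀ᵐ x ∂μ, x ∈ closedBall (0 : EuclideanSpace ℝ (Fin d)) R := by
    rw [ae_iff]; exact hsupp
  have hpt : ∀ x ∈ closedBall (0 : EuclideanSpace ℝ (Fin d)) R,
      rexp (-m - k) * rexp (infConv (δ ^ 2 + 4 * R ^ 2) g (x + z)) + 
        rexp m * rexp (-g (x + z')) ≤ 2 := by
    intro x hx
    have ha : 0 ≤ g (x + z') - m := sub_nonneg.2 (hmin hx)
    obtain ⟨θ, hθ0, hθ1, hθ⟩ := exp_aux _ ha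
    refine le_trans ?_ hθ
    rw [← Real.exp_add, ← Real.exp_add]
    refine add_le_add (Real.exp_le_exp.2 ?_) (Real.exp_le_exp.2 (by linarith))
    have hle : infConv (δ ^ 2 + 4 * R ^ 2) g (x + z) ≤ _ :=
      ciInf_le (infConv_bdd (by positivity) g hbdd (x + z)) ((1 - θ) • (x + z') + θ • (y0 + z'))
    have hcv := hconv.2 (Set.mem_univ (x + z')) (Set.mem_univ (y0 + z'))
      (show 0 ≤ 1 - θ by linarith) hθ0 (by ring)
    have hvec : x + z - ((1 - θ) • (x + z') + θ • (y0 + z')) = θ • (x - y0) + (z - z') := by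
      module
    have hcost := cost_split (θ • (x - y0)) (z - z') (4 * R ^ 2) (δ ^ 2) (by positivity)
      (by positivity)
    have hn : ‖x - y0‖ ≤ 2 * R := by
      have h1 : ‖x‖ ≤ R := by simpa using hx
      have h2 : ‖y0‖ ≤ R := by simpa using hy0
      linarith [norm_sub_le x y0]
    have hc2 : ‖θ • (x - y0)‖ ^ 2 / (4 * (4 * R ^ 2)) ≤ θ ^ 2 / 4 := by
      rw [norm_smul, mul_pow, Real.norm_eq_abs, sq_abs, div_le_div_iff₀ (by positivity) (by norm_num)]
      have : ‖x - y0‖ ^ 2 ≤ (2 * R) ^ 2 := by gcongr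
      nlinarith [mul_le_mul_of_nonneg_left this (sq_nonneg θ)]
    simp only [hvec] at hle
    simp only [smul_eq_mul] at hcv
    rw [← hm] at hcv
    linarith
  set P := ∫⁻ x, ENNReal.ofReal (rexp (infConv (δ ^ 2 + 4 * R ^ 2) g (x + z))) ∂μ with hP
  set V := ∫⁻ x, ENNReal.ofReal (rexp (-g (x + z'))) ∂μ with hV
  have hQm : Measurable fun x => infConv (δ ^ 2 + 4 * R ^ 2) g (x + z) :=
    (infConv_meas (by positivity) g hbdd).comp (measurable_id.add_const z)
  have hgm : Measurable fun x => g (x + z') := hg.comp (measurable_id.add_const z')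
  have key : ENNReal.ofReal (rexp (-m - k)) * P + ENNReal.ofReal (rexp m) * V ≤ 2 := by
    rw [hP, hV, ← lintegral_const_mul _ (by fun_prop), ← lintegral_const_mul _ (by fun_prop),
      ← lintegral_add_left (by fun_prop)]
    calc _ ≤ ∫⁻ x, 2 ∂μ := by
          refine lintegral_mono_ae ?_
          filter_upwards [hae] with x hx
          rw [← ENNReal.ofReal_mul (by positivity), ← ENNReal.ofReal_mul (by positivity),
            ← ENNReal.ofReal_add (by positivity) (by positivity)]
          exact (ENNReal.ofReal_le_ofReal (hpt x hx)).trans (by simp)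
      _ = 2 := by simp
  clear_value P V
  have hL := ne_top_of_le_ne_top (by simp) key
  rw [ENNReal.add_ne_top] at hL
  have hU : P ≠ ∞ := by
    rintro rfl
    apply hL.1
    rw [ENNReal.mul_top]; simpa using Real.exp_pos _
  have hV : V ≠ ∞ := by
    rintro rfl
    apply hL.2
    rw [ENNReal.mul_top]; simpa using Real.exp_pos _
  lift P to NNReal using hU
  lift V to NNReal using hV
  have key' := ENNReal.toReal_mono (by simp) key
  rw [ENNReal.toReal_add hL.1 hL.2] at key'
  simp only [ENNReal.toReal_mul, ENNReal.toReal_ofReal (Real.exp_pos _).le,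
    ENNReal.coe_toReal, ENNReal.toReal_ofNat] at key'
  rw [← ENNReal.coe_mul, ENNReal.le_ofReal_iff_toReal_le ENNReal.coe_ne_top (Real.exp_pos _).le]
  simp only [ENNReal.coe_toReal, NNReal.coe_mul]
  have h4 : (rexp (-m - k) * (P : ℝ)) * (rexp m * V) ≤ 1 := by
    nlinarith [sq_nonneg (rexp (-m - k) * (P : ℝ) - rexp m * V),
      show 0 ≤ rexp (-m - k) * (P : ℝ) by positivity, show 0 ≤ rexp m * (V : ℝ) by positivity]
  have h5 : rexp (-m - k) * rexp m * rexp k = 1 := by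
    rw [← Real.exp_add, ← Real.exp_add]; ring_nf; simp
  calc (P * V : ℝ) = (rexp (-m - k) * rexp m * rexp k) * (P * V) := by rw [h5, one_mul]
    _ = rexp k * ((rexp (-m - k) * (P : ℝ)) * (rexp m * V)) := by ring
    _ ≤ rexp k * 1 := by gcongr
    _ = _ := mul_one _

theorem gauss_total (d : ℕ) (δ : ℝ) (hδ : 0 < δ) :
    ∫⁻ z : EuclideanSpace ℝ (Fin d), ENNReal.ofReal ((2 * π * δ ^ 2) ^ (-(d : ℝ) / 2) *
      Real.exp (-‖z‖ ^ 2 / (2 * δ ^ 2))) = 1 := by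
  have hb : 0 < 1 / (2 * δ ^ 2) := by positivity
  have h := GaussianFourier.integral_rexp_neg_mul_sq_norm (V := EuclideanSpace ℝ (Fin d)) hb
  have hpos : 0 < 2 * π * δ ^ 2 := by positivity
  have hi : Integrable fun v : EuclideanSpace ℝ (Fin d) => rexp (-(1 / (2 * δ ^ 2)) * ‖v‖ ^ 2) := by
    by_contra hc
    rw [integral_undef hc] at h
    have : 0 < (π / (1 / (2 * δ ^ 2))) ^ ((Module.finrank ℝ (EuclideanSpace ℝ (Fin d)) : ℝ) / 2) :=
      by positivity
    linarith
  have he : ∀ z : EuclideanSpace ℝ (Fin d), -‖z‖ ^ 2 / (2 * δ ^ 2) = -(1 / (2 * δ ^ 2)) * ‖z‖ ^ 2 :=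
    fun z => by ring
  simp_rw [he]
  rw [← ofReal_integral_eq_lintegral_ofReal (hi.const_mul _)
    (.of_forall fun z => by positivity), integral_const_mul, h]
  have : π / (1 / (2 * δ ^ 2)) = 2 * π * δ ^ 2 := by field_simp
  rw [this, finrank_euclideanSpace_fin, ← Real.rpow_add hpos]
  ring_nf
  simp

/-- The convex `τ`-property for `μ ⋆ γ_δ` with `C = δ² + 4R²`:
`E[exp(Q_C g(S))] E[exp(-g(S))] ≤ 1` for every convex measurable `g`
bounded below, where `S` has law `μ ⋆ γ_δ`. -/
theorem tau_property_conv (d : ℕ) (hd : 1 ≤ d) (R δ : ℝ) (hR : 0 < R) (hδ : 0 < δ)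
    (μ : Measure (EuclideanSpace ℝ (Fin d))) [IsProbabilityMeasure μ]
    (hsupp : μ (closedBall (0 : EuclideanSpace ℝ (Fin d)) R)ᶜ = 0)
    (g : EuclideanSpace ℝ (Fin d) → ℝ) (hg : Measurable g)
    (hconv : ConvexOn ℝ Set.univ g) (hbdd : ∃ b : ℝ, ∀ y, b ≤ g y) :
    (∫⁻ x, ENNReal.ofReal (Real.exp (infConv (δ ^ 2 + 4 * R ^ 2) g x))
        ∂(mconv μ (gaussδ d δ))) *
      (∫⁻ x, ENNReal.ofReal (Real.exp (-g x)) ∂(mconv μ (gaussδ d δ))) ≤ 1 := by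
  have hQm : Measurable (infConv (δ ^ 2 + 4 * R ^ 2) g) := infConv_meas (by positivity) g hbdd
  set φ : EuclideanSpace ℝ (Fin d) → ℝ := fun z =>
    (2 * π * δ ^ 2) ^ (-(d : ℝ) / 2) * Real.exp (-‖z‖ ^ 2 / (2 * δ ^ 2)) with hφ
  have hφm : Measurable fun z => ENNReal.ofReal (φ z) := by fun_prop
  have hφ0 : ∀ z, 0 ≤ φ z := fun z => by positivity
  have hgauss : gaussδ d δ = volume.withDensity fun z => ENNReal.ofReal (φ z) := rfl
  have hfin : IsProbabilityMeasure (gaussδ d δ) :=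
    ⟨by rw [hgauss, withDensity_apply _ .univ, setLIntegral_univ]; exact gauss_total d δ hδ⟩
  have hred : ∀ f : EuclideanSpace ℝ (Fin d) → ℝ≥0∞, Measurable f →
      ∫⁻ x, f x ∂(mconv μ (gaussδ d δ)) =
        ∫⁻ z, ENNReal.ofReal (φ z) * ∫⁻ x, f (x + z) ∂μ := by
    intro f hf
    have hf2 : Measurable fun p : EuclideanSpace ℝ (Fin d) × EuclideanSpace ℝ (Fin d) =>
        f (p.1 + p.2) := hf.comp (measurable_fst.add measurable_snd)
    rw [mconv, lintegral_map hf (by fun_prop), lintegral_prod_symm' _ hf2,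
      hgauss, lintegral_withDensity_eq_lintegral_mul _ hφm hf2.lintegral_prod_left']
    rfl
  have hmz : ∀ f : EuclideanSpace ℝ (Fin d) → ℝ≥0∞, Measurable f →
      Measurable fun z => ENNReal.ofReal (φ z) * ∫⁻ x, f (x + z) ∂μ := by
    intro f hf
    have hf2 : Measurable fun p : EuclideanSpace ℝ (Fin d) × EuclideanSpace ℝ (Fin d) =>
        f (p.1 + p.2) := hf.comp (measurable_fst.add measurable_snd)
    exact hφm.mul hf2.lintegral_prod_left'
  have hm1 : Measurable fun x => ENNReal.ofReal (rexp (infConv (δ ^ 2 + 4 * R ^ 2) g x)) := by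
    fun_prop
  have hm2 : Measurable fun x => ENNReal.ofReal (rexp (-g x)) := by fun_prop
  rw [hred _ hm1, hred _ hm2]
  have h1 : (∫⁻ z, ENNReal.ofReal (φ z)) = 1 := gauss_total d δ hδ
  rw [show (1 : ℝ≥0∞) = (∫⁻ z, ENNReal.ofReal (φ z)) ^ 2 by rw [h1, one_pow]]
  refine pl_euclid d _ _ _ (hmz _ hm1) (hmz _ hm2) hφm ?_
  intro z z'
  have hstep := mu_step d R δ hR hδ μ hsupp g hg hconv hbdd z z'
  calc _ = ENNReal.ofReal (φ z) * ENNReal.ofReal (φ z') *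
        ((∫⁻ x, ENNReal.ofReal (rexp (infConv (δ ^ 2 + 4 * R ^ 2) g (x + z))) ∂μ) *
        (∫⁻ x, ENNReal.ofReal (rexp (-g (x + z'))) ∂μ)) := by ring
    _ ≤ ENNReal.ofReal (φ z) * ENNReal.ofReal (φ z') *
        ENNReal.ofReal (rexp (‖z - z'‖ ^ 2 / (4 * δ ^ 2))) := by gcongr
    _ = _ := by
      rw [← ENNReal.ofReal_mul (hφ0 _), ← ENNReal.ofReal_mul (mul_nonneg (hφ0 _) (hφ0 _)),
        ← ENNReal.ofReal_pow (hφ0 _)]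
      congr 1
      simp only [hφ]
      rw [mul_pow, ← Real.exp_nat_mul]
      have hpar := parallelogram_law_with_norm ℝ z z'
      have hexp : ((2 : ℕ) : ℝ) * (-‖(2⁻¹ : ℝ) • (z + z')‖ ^ 2 / (2 * δ ^ 2)) =
          -‖z‖ ^ 2 / (2 * δ ^ 2) + -‖z'‖ ^ 2 / (2 * δ ^ 2) + ‖z - z'‖ ^ 2 / (4 * δ ^ 2) := by
        rw [norm_smul, mul_pow, Real.norm_eq_abs, sq_abs]
        have : ‖z + z'‖ ^ 2 = 2 * (‖z‖ ^ 2 + ‖z'‖ ^ 2) - ‖z - z'‖ ^ 2 := by nlinarith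
        rw [this]
        field_simp
        push_cast
        ring
      rw [hexp, Real.exp_add, Real.exp_add]
      ring
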